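/- Let ι be a nonempty finite index set and for each i ∈ ι let κ_i be a nonempty finite type; consider the Hilbert space H = ⊗_{i∈ι} ℂ^{κ_i}, with operators on H represented as matrices M indexed by the product type Π_{i∈ι} κ_i. Call a matrix M 'local at i' if there is a matrix A : κ_i × κ_i → ℂ with M(x,y) = A(x_i, y_i) · ∏_{j≠i} δ_{x_j,y_j}. If U is a unitary matrix on H such that for every i ∈ ι and every matrix O local at i, the conjugate U*·O·U is also local at i, then there exists a family of unitary matrices A_i on ℂ^{κ_i} such that U(x,y) = ∏_{i∈ι} A_i(x_i, y_i); that is, U is the tensor (Kronecker) product of local unitaries U = ⊗_{i∈ι} A_i. -/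

import Mathlib

open scoped BigOperators

/-- A matrix on the product index type `Π i, κ i` (i.e. an operator on the tensor product
`⊗_{i} ℂ^{κ i}`) is *local at `i`* if it acts as some matrix `A` on the `i`-th tensor factor
and as the identity (Kronecker delta) on all other factors. -/
def IsLocalAt {ι : Type*} [Fintype ι] [DecidableEq ι] {κ : ι → Type*}
    [∀ i, Fintype (κ i)] [∀ i, DecidableEq (κ i)]
    (i : ι) (M : Matrix (∀ j, κ j) (∀ j, κ j) ℂ) : Prop :=
  ∃ A : Matrix (κ i) (κ i) ℂ, ∀ x y : ∀ j, κ j,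
    M x y = A (x i) (y i) * ∏ j ∈ Finset.univ.erase i, (if x j = y j then (1 : ℂ) else 0)

theorem sum_sum_comm_sum_sum {α β γ δ M : Type*} [Fintype α] [Fintype β] [Fintype γ]
    [Fintype δ] [AddCommMonoid M] (f : α → β → γ → δ → M) :
    ∑ a, ∑ b, ∑ c, ∑ d, f a b c d = ∑ c, ∑ d, ∑ a, ∑ b, f a b c d := by
  simpa only [Fintype.sum_prod_type] using
    Finset.sum_comm (s := (Finset.univ : Finset (α × β))) (t := (Finset.univ : Finset (γ × δ)))
      (f := fun p q => f p.1 p.2 q.1 q.2)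

section LocalOperators

variable {ι : Type*} [Fintype ι] [DecidableEq ι] {κ : ι → Type*} [∀ i, DecidableEq (κ i)]

/-- The operator acting as `A` on the `i`-th tensor factor and trivially on the others. -/
def localOp (i : ι) (A : Matrix (κ i) (κ i) ℂ) : Matrix (∀ j, κ j) (∀ j, κ j) ℂ :=
  fun x y => A (x i) (y i) * ∏ j ∈ Finset.univ.erase i, (if x j = y j then (1 : ℂ) else 0)

theorem prod_erase_ite_update (i : ι) (x : ∀ j, κ j) (c : κ i) :
    ∏ j ∈ Finset.univ.erase i, (if x j = Function.update x i c j then (1 : ℂ) else 0) = 1 :=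
  Finset.prod_eq_one fun j hj => by simp [Finset.ne_of_mem_erase hj]

theorem prod_erase_ite_eq_zero (i : ι) {x y : ∀ j, κ j}
    (h : y ∉ Set.range (Function.update x i)) :
    ∏ j ∈ Finset.univ.erase i, (if x j = y j then (1 : ℂ) else 0) = 0 := by
  have : ∃ j, j ≠ i ∧ x j ≠ y j := by
    by_contra! hc
    refine h ⟨y i, funext fun j => ?_⟩
    rcases eq_or_ne j i with rfl | hj
    · simp
    · simp [hj, hc j hj]
  obtain ⟨j, hj, hxy⟩ := this
  exact Finset.prod_eq_zero (i := j) (by simp [hj]) (by simp [hxy])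

variable [∀ i, Fintype (κ i)]

theorem isLocalAt_iff_exists_localOp (i : ι) (M : Matrix (∀ j, κ j) (∀ j, κ j) ℂ) :
    IsLocalAt i M ↔ ∃ A, M = localOp i A :=
  exists_congr fun _ => ⟨fun h => funext₂ h, fun h x y => congrFun₂ h x y⟩

theorem localOp_mul_apply (i : ι) (A : Matrix (κ i) (κ i) ℂ)
    (M : Matrix (∀ j, κ j) (∀ j, κ j) ℂ) (x y : ∀ j, κ j) :
    (localOp i A * M) x y = ∑ c, A (x i) c * M (Function.update x i c) y := by
  rw [Matrix.mul_apply]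
  symm
  refine Fintype.sum_of_injective (Function.update x i) (Function.update_injective x i) _ _
    (fun w hw => ?_) fun c => ?_
  · simp [localOp, prod_erase_ite_eq_zero i hw]
  · simp only [localOp, prod_erase_ite_update]
    simp

theorem mul_localOp_apply (i : ι) (A : Matrix (κ i) (κ i) ℂ)
    (M : Matrix (∀ j, κ j) (∀ j, κ j) ℂ) (x y : ∀ j, κ j) :
    (M * localOp i A) x y = ∑ c, M x (Function.update y i c) * A c (y i) := by
  rw [Matrix.mul_apply]
  symm
  refine Fintype.sum_of_injective (Function.update y i) (Function.update_injective y i) _ _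
    (fun w hw => ?_) fun c => ?_
  · simp only [localOp, eq_comm (a := w _), prod_erase_ite_eq_zero i hw, mul_zero]
  · simp only [localOp, eq_comm (b := y _), prod_erase_ite_update]
    simp

theorem localOp_mul_localOp (i : ι) (A B : Matrix (κ i) (κ i) ℂ) :
    localOp i A * localOp i B = localOp i (A * B) := by
  ext x y
  rw [localOp_mul_apply, localOp, Matrix.mul_apply, Finset.sum_mul]
  refine Finset.sum_congr rfl fun c _ => ?_
  rw [localOp, Function.update_self, mul_assoc]
  congr 2
  refine Finset.prod_congr rfl fun j hj => ?_
  rw [Function.update_of_ne (Finset.ne_of_mem_erase hj)]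

theorem trace_localOp (i : ι) (A : Matrix (κ i) (κ i) ℂ) :
    (localOp i A).trace = Fintype.card (∀ j : {j // j ≠ i}, κ j) * A.trace := by
  have h : (localOp i A).trace = ∑ x : ∀ j, κ j, A (x i) (x i) := by
    simp [Matrix.trace, localOp]
  rw [h, ← (Equiv.piSplitAt i κ).symm.sum_comp, Fintype.sum_prod_type]
  simp [Equiv.piSplitAt, Matrix.trace, Finset.mul_sum]

/-- If `U` intertwines the matrix units at site `i` with the local operators given by `F`,
then `F` satisfies the same completeness relation as the matrix units. -/
theorem sum_mul_eq_ite_of_localOp_mul_eq [∀ i, Nonempty (κ i)]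
    {U : Matrix (∀ i, κ i) (∀ i, κ i) ℂ} (hU : U ∈ Matrix.unitaryGroup (∀ i, κ i) ℂ) (i : ι)
    {F : κ i → κ i → Matrix (κ i) (κ i) ℂ}
    (hF : ∀ a b, star U * localOp i (Matrix.single a b 1) * U = localOp i (F a b))
    (c d c' d' : κ i) :
    ∑ a, ∑ b, F a b c d * F b a c' d' = if c = d' ∧ d = c' then 1 else 0 := by
  have htr : ∀ a b a' b', (F a b * F b' a').trace = if a = a' ∧ b = b' then 1 else 0 := by
    intro a b a' b'
    have hN : (Fintype.card (∀ j : {j // j ≠ i}, κ j) : ℂ) ≠ 0 := by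
      exact_mod_cast Fintype.card_ne_zero
    refine mul_left_cancel₀ hN ?_
    have hUU : U * star U = 1 := Matrix.mem_unitaryGroup_iff.1 hU
    rw [← trace_localOp, ← localOp_mul_localOp, ← hF, ← hF]
    calc (star U * localOp i (Matrix.single a b 1) * U *
          (star U * localOp i (Matrix.single b' a' 1) * U)).trace
        = (star U * (localOp i (Matrix.single a b 1) * (U * star U) *
            localOp i (Matrix.single b' a' 1) * U)).trace := by simp only [mul_assoc]
      _ = (localOp i (Matrix.single a b 1 * Matrix.single b' a' 1)).trace := by
          rw [Matrix.trace_mul_comm, hUU, mul_one, mul_assoc, hUU, mul_one, localOp_mul_localOp]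
      _ = _ := by
          rw [trace_localOp]
          by_cases hb : b = b'
          · subst hb
            by_cases ha : a = a'
            · subst ha; simp
            · simp [ha]
          · simp [hb]
  let P : Matrix (κ i × κ i) (κ i × κ i) ℂ := fun p q => F p.1 p.2 q.1 q.2
  let Q : Matrix (κ i × κ i) (κ i × κ i) ℂ := fun q p => F p.2 p.1 q.2 q.1
  have hPQ : P * Q = 1 := by
    ext ⟨a, b⟩ ⟨a', b'⟩
    rw [Matrix.mul_apply, Fintype.sum_prod_type, Matrix.one_apply]
    simpa [Matrix.trace, Matrix.mul_apply] using htr a b a' b'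
  have hQP' : Q * P = 1 := mul_eq_one_comm.1 hPQ
  have hQP := congrFun₂ hQP' (d', c') (c, d)
  rw [Matrix.mul_apply, Fintype.sum_prod_type, Matrix.one_apply] at hQP
  simp only [Prod.mk.injEq] at hQP
  simpa only [P, Q, mul_comm, eq_comm] using hQP

/-- Site-wise exchange relation: `U ⊗ U` commutes with the flip of the two copies of site `i`. -/
theorem apply_update_mul_apply_update [∀ i, Nonempty (κ i)]
    {U : Matrix (∀ i, κ i) (∀ i, κ i) ℂ} (hU : U ∈ Matrix.unitaryGroup (∀ i, κ i) ℂ) (i : ι)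
    (hloc : ∀ O, IsLocalAt i O → IsLocalAt i (star U * O * U)) (x y x' y' : ∀ i, κ i) :
    U (Function.update x i (x' i)) y * U (Function.update x' i (x i)) y' =
      U x (Function.update y i (y' i)) * U x' (Function.update y' i (y i)) := by
  have hex : ∀ a b, ∃ B, star U * localOp i (Matrix.single a b 1) * U = localOp i B :=
    fun a b => (isLocalAt_iff_exists_localOp _ _).1
      (hloc _ ((isLocalAt_iff_exists_localOp _ _).2 ⟨_, rfl⟩))
  choose F hF using hex
  have hint : ∀ a b, localOp i (Matrix.single a b 1) * U = U * localOp i (F a b) := by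
    intro a b
    rw [← hF, ← mul_assoc, ← mul_assoc, Matrix.mem_unitaryGroup_iff.1 hU, one_mul]
  have hleft : ∀ (a b : κ i) (x y : ∀ i, κ i), (localOp i (Matrix.single a b 1) * U) x y =
      if a = x i then U (Function.update x i b) y else 0 := by
    intro a b x y
    rw [localOp_mul_apply, Finset.sum_eq_single b]
    · simp [Matrix.single_apply]
    · intro c _ hc
      simp [hc.symm]
    · simp
  have hL : ∑ a : κ i, ∑ b : κ i, (localOp i (Matrix.single a b 1) * U) x y *
      (localOp i (Matrix.single b a 1) * U) x' y' =
      U (Function.update x i (x' i)) y * U (Function.update x' i (x i)) y' := by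
    simp [hleft]
  rw [← hL]
  simp only [hint, mul_localOp_apply, Finset.sum_mul_sum]
  calc ∑ a, ∑ b, ∑ c, ∑ c', U x (Function.update y i c) * F a b c (y i) *
        (U x' (Function.update y' i c') * F b a c' (y' i))
      = ∑ c, ∑ c', U x (Function.update y i c) * U x' (Function.update y' i c') *
          ∑ a, ∑ b, F a b c (y i) * F b a c' (y' i) := by
        simp only [Finset.mul_sum]
        rw [sum_sum_comm_sum_sum]
        simp only [mul_mul_mul_comm]
    _ = _ := by
        simp only [sum_mul_eq_ite_of_localOp_mul_eq hU i hF]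
        simp [ite_and]

/-- The entries of `U` factor over the sites, relative to a base entry. -/
theorem apply_piecewise_mul_pow [∀ i, Nonempty (κ i)]
    {U : Matrix (∀ i, κ i) (∀ i, κ i) ℂ} (hU : U ∈ Matrix.unitaryGroup (∀ i, κ i) ℂ)
    (hloc : ∀ i O, IsLocalAt i O → IsLocalAt i (star U * O * U)) (x₀ y₀ x y : ∀ i, κ i)
    (s : Finset ι) :
    U (s.piecewise x x₀) (s.piecewise y y₀) * U x₀ y₀ ^ s.card =
      U x₀ y₀ * ∏ i ∈ s, U (Function.update x₀ i (x i)) (Function.update y₀ i (y i)) := by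
  induction s using Finset.induction_on with
  | empty => simp
  | insert i s hi ih =>
    have h := apply_update_mul_apply_update hU i (hloc i)
      (Function.update (s.piecewise x x₀) i (x i)) (s.piecewise y y₀)
      x₀ (Function.update y₀ i (y i))
    have hx : Function.update (s.piecewise x x₀) i (x₀ i) = s.piecewise x x₀ := by
      simp [hi]
    have hy : Function.update y₀ i (s.piecewise y y₀ i) = y₀ := by simp [hi]
    simp only [Function.update_idem, Function.update_self, hx, hy] at h
    rw [Finset.piecewise_insert, Finset.piecewise_insert, Finset.card_insert_of_notMem hi,
      Finset.prod_insert hi]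
    linear_combination (-U x₀ y₀ ^ s.card) * h +
      U (Function.update x₀ i (x i)) (Function.update y₀ i (y i)) * ih

/-- A unitary matrix preserving locality at every site is a Kronecker product. -/
theorem exists_apply_eq_prod [Nonempty ι] [∀ i, Nonempty (κ i)]
    {U : Matrix (∀ i, κ i) (∀ i, κ i) ℂ} (hU : U ∈ Matrix.unitaryGroup (∀ i, κ i) ℂ)
    (hloc : ∀ i O, IsLocalAt i O → IsLocalAt i (star U * O * U)) :
    ∃ B : ∀ i, Matrix (κ i) (κ i) ℂ, ∀ x y, U x y = ∏ i, B i (x i) (y i) := by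
  have hne : ∃ x₀ y₀, U x₀ y₀ ≠ 0 := by
    by_contra! h
    have h0 : U = 0 := Matrix.ext h
    have h1 := Matrix.mem_unitaryGroup_iff.1 hU
    rw [h0, zero_mul] at h1
    exact zero_ne_one h1
  obtain ⟨x₀, y₀, hc⟩ := hne
  obtain ⟨d, hd⟩ := IsAlgClosed.exists_pow_nat_eq (U x₀ y₀ / U x₀ y₀ ^ Fintype.card ι)
    (Fintype.card_pos (α := ι))
  refine ⟨fun i => Matrix.of fun a b =>
    d * U (Function.update x₀ i a) (Function.update y₀ i b), fun x y => ?_⟩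
  have h := apply_piecewise_mul_pow hU hloc x₀ y₀ x y Finset.univ
  rw [Finset.piecewise_univ, Finset.piecewise_univ, Finset.card_univ] at h
  simp only [Matrix.of_apply, Finset.prod_mul_distrib, Finset.prod_const, Finset.card_univ, hd]
  field_simp
  linear_combination h

/-- If a Kronecker product is unitary, its factors can be rescaled to be unitary. -/
theorem exists_unitary_of_apply_eq_prod [∀ i, Nonempty (κ i)]
    {U : Matrix (∀ i, κ i) (∀ i, κ i) ℂ} (hU : U ∈ Matrix.unitaryGroup (∀ i, κ i) ℂ)
    (B : ∀ i, Matrix (κ i) (κ i) ℂ) (hB : ∀ x y, U x y = ∏ i, B i (x i) (y i)) :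
    ∃ A : ∀ i, Matrix (κ i) (κ i) ℂ, (∀ i, A i ∈ Matrix.unitaryGroup (κ i) ℂ) ∧
      ∀ x y : ∀ i, κ i, U x y = ∏ i, A i (x i) (y i) := by
  have hG : ∀ x y : ∀ i, κ i,
      ∏ i, (B i * star (B i)) (x i) (y i) = if x = y then 1 else 0 := by
    intro x y
    rw [← Matrix.one_apply, ← Matrix.mem_unitaryGroup_iff.1 hU]
    simp only [Matrix.mul_apply, Matrix.star_apply, hB, star_prod, ← Finset.prod_mul_distrib,
      Finset.prod_univ_sum, Fintype.piFinset_univ]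
  let z : ∀ i, κ i := fun i => Classical.arbitrary _
  let r : ι → ℝ := fun i => ∑ w, ‖B i (z i) w‖ ^ 2
  have hr : ∀ i, (B i * star (B i)) (z i) (z i) = (r i : ℂ) := by
    intro i
    simp [r, Matrix.mul_apply, Matrix.star_apply, Complex.mul_conj']
  have hprod : ∏ i, r i = 1 := by
    have := hG z z
    simp only [hr, if_true] at this
    exact_mod_cast this
  have hpos : ∀ i, 0 < r i := fun i =>
    lt_of_le_of_ne (Finset.sum_nonneg fun _ _ => by positivity) fun h =>
      zero_ne_one ((Finset.prod_eq_zero (Finset.mem_univ i) h.symm).symm.trans hprod)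
  have hscalar : ∀ i, B i * star (B i) = (r i : ℂ) • 1 := by
    intro i
    have hK : ∏ j ∈ Finset.univ.erase i, (r j : ℂ) ≠ 0 :=
      Finset.prod_ne_zero_iff.2 fun j _ => by exact_mod_cast (hpos j).ne'
    ext a b
    refine mul_right_cancel₀ hK ?_
    have h := hG (Function.update z i a) (Function.update z i b)
    have hcongr : ∏ j ∈ Finset.univ.erase i, (B j * star (B j))
        (Function.update z i a j) (Function.update z i b j) =
        ∏ j ∈ Finset.univ.erase i, (r j : ℂ) :=
      Finset.prod_congr rfl fun j hj => by
        rw [Function.update_of_ne (Finset.ne_of_mem_erase hj),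
          Function.update_of_ne (Finset.ne_of_mem_erase hj), hr]
    rw [← Finset.mul_prod_erase _ _ (Finset.mem_univ i), hcongr, Function.update_self,
      Function.update_self] at h
    rw [h, Matrix.smul_apply, smul_eq_mul, mul_right_comm,
      Finset.mul_prod_erase _ (fun j => (r j : ℂ)) (Finset.mem_univ i), ← Complex.ofReal_prod,
      hprod, Complex.ofReal_one, one_mul, Matrix.one_apply]
    simp [(Function.update_injective z i).eq_iff]
  refine ⟨fun i => ((√(r i))⁻¹ : ℂ) • B i, fun i => ?_, fun x y => ?_⟩
  · have hs : (√(r i) : ℂ) * √(r i) = r i := by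
      exact_mod_cast Real.mul_self_sqrt (hpos i).le
    have h0 : (r i : ℂ) ≠ 0 := by exact_mod_cast (hpos i).ne'
    rw [Matrix.mem_unitaryGroup_iff, star_smul, smul_mul_smul_comm, hscalar, smul_smul]
    simp only [star_inv₀, Complex.star_def, Complex.conj_ofReal]
    rw [← mul_inv, hs, inv_mul_cancel₀ h0, one_smul]
  · have hs : ∏ i, √(r i) = 1 := by
      rw [← Real.sqrt_prod _ fun i _ => (hpos i).le, hprod, Real.sqrt_one]
    simp only [Matrix.smul_apply, smul_eq_mul, Finset.prod_mul_distrib, Finset.prod_inv_distrib,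
      ← Complex.ofReal_prod, hs, hB]
    simp

end LocalOperators

/-- **Lattice splittability theorem.**  If a unitary `U` on a finite tensor product of
finite-dimensional Hilbert spaces conjugates every operator that is local at a tensor factor
into another operator local at the same factor, then `U` is itself a tensor (Kronecker)
product of local unitaries. -/
theorem lattice_splittability {ι : Type*} [Fintype ι] [DecidableEq ι] [Nonempty ι]
    {κ : ι → Type*} [∀ i, Fintype (κ i)] [∀ i, DecidableEq (κ i)] [∀ i, Nonempty (κ i)]
    (U : Matrix (∀ i, κ i) (∀ i, κ i) ℂ)
    (hU : U ∈ Matrix.unitaryGroup (∀ i, κ i) ℂ)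
    (hloc : ∀ (i : ι) (O : Matrix (∀ j, κ j) (∀ j, κ j) ℂ),
      IsLocalAt i O → IsLocalAt i (star U * O * U)) :
    ∃ A : ∀ i, Matrix (κ i) (κ i) ℂ,
      (∀ i, A i ∈ Matrix.unitaryGroup (κ i) ℂ) ∧
      ∀ x y : ∀ i, κ i, U x y = ∏ i, A i (x i) (y i) := by
  obtain ⟨B, hB⟩ := exists_apply_eq_prod hU hloc
  exact exists_unitary_of_apply_eq_prod hU B hB
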